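/- (Uniqueness of the Dirichlet problem for λ-translating graphs.) Let D ⊆ ℝ² be a nonempty bounded open set, let λ ∈ ℝ, and let u₁, u₂ be continuous on the closure of D and both satisfy the λ-soliton graph equation on D. If u₁(x) = u₂(x) for every x ∈ ∂D, then u₁ = u₂ on the closure of D. -/

import Mathlib

open MeasureTheory

noncomputable section

/-- The Euclidean plane. -/
abbrev E2 := EuclideanSpace ℝ (Fin 2)

/-- `W u x = √(1 + ‖∇u(x)‖²)`. -/
noncomputable def W (u : E2 → ℝ) (x : E2) : ℝ := Real.sqrt (1 + ‖gradient u x‖ ^ 2)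

/-- The divergence of a vector field `X : ℝ² → ℝ²`: `div X = ∂₁X₁ + ∂₂X₂`. -/
noncomputable def div2 (X : E2 → E2) (x : E2) : ℝ :=
  ∑ i : Fin 2, fderiv ℝ X x (EuclideanSpace.single i 1) i

/-- `u` satisfies the λ-soliton graph equation on the open set `D`: `u` is C² on `D` and
`div (∇u / W(u)) = 2λ + 1/W(u)` at every point of `D`. -/
def SatisfiesSolitonEq (lam : ℝ) (D : Set E2) (u : E2 → ℝ) : Prop :=
  ContDiffOn ℝ 2 u D ∧
    ∀ x ∈ D, div2 (fun y => (W u y)⁻¹ • gradient u y) x = 2 * lam + (W u x)⁻¹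

end

open Filter Topology

/-- Second derivative test: at a local maximum the second derivative is nonpositive. -/
lemma IsLocalMax.second_deriv_nonpos {f f' : ℝ → ℝ} {a c : ℝ} (hmax : IsLocalMax f a)
    (hf : ∀ᶠ t in 𝓝 a, HasDerivAt f (f' t) t) (hf' : HasDerivAt f' c a) : c ≤ 0 := by
  by_contra! hc
  have hd : deriv f =ᶠ[𝓝 a] f' := hf.mono fun t ht => ht.deriv
  have hdd : deriv (deriv f) a = c := by rw [hd.deriv_eq, hf'.deriv]
  have hmin : IsLocalMin f a :=
    isLocalMin_of_deriv_deriv_pos (by rwa [hdd]) hmax.deriv_eq_zero hf.self_of_nhds.continuousAt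
  have hconst : f =ᶠ[𝓝 a] fun _ => f a := by
    filter_upwards [hmax, hmin] with t h₁ h₂ using le_antisymm h₁ h₂
  have h0 : deriv (deriv f) a = 0 := by
    rw [hconst.deriv.deriv_eq]; simp
  linarith

lemma contDiffOn_gradient {D : Set E2} (hD : IsOpen D) {u : E2 → ℝ} (hu : ContDiffOn ℝ 2 u D) :
    ContDiffOn ℝ 1 (gradient u) D := by
  have h : ContDiffOn ℝ 1 (fderiv ℝ u) D := hu.fderiv_of_isOpen hD (by norm_num)
  exact (InnerProductSpace.toDual ℝ E2).symm.contDiff.comp_contDiffOn h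

lemma W_pos (u : E2 → ℝ) (x : E2) : 0 < W u x := Real.sqrt_pos.2 (by positivity)

lemma W_sq (u : E2 → ℝ) (x : E2) :
    W u x ^ 2 = 1 + gradient u x 0 ^ 2 + gradient u x 1 ^ 2 := by
  rw [W, Real.sq_sqrt (by positivity), EuclideanSpace.norm_sq_eq]
  simp [Fin.sum_univ_two, add_assoc]

lemma hasFDerivAt_W {u : E2 → ℝ} {x : E2} (hg : DifferentiableAt ℝ (gradient u) x) :
    HasFDerivAt (W u) ((W u x)⁻¹ •
      (innerSL ℝ (gradient u x)).comp (fderiv ℝ (gradient u) x)) x := by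
  have h := (hg.hasFDerivAt.norm_sq.const_add 1).sqrt (by positivity)
  refine h.congr_fderiv ?_
  ext v
  simp [W]
  ring

/-- The soliton equation in nondivergence form. -/
lemma SatisfiesSolitonEq.nondivergence {lam : ℝ} {D : Set E2} (hD : IsOpen D) {u : E2 → ℝ}
    (hu : SatisfiesSolitonEq lam D u) {x : E2} (hx : x ∈ D) :
    (1 + gradient u x 1 ^ 2) * fderiv ℝ (gradient u) x (EuclideanSpace.single 0 1) 0
      - gradient u x 0 * gradient u x 1 *
        (fderiv ℝ (gradient u) x (EuclideanSpace.single 0 1) 1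
          + fderiv ℝ (gradient u) x (EuclideanSpace.single 1 1) 0)
      + (1 + gradient u x 0 ^ 2) * fderiv ℝ (gradient u) x (EuclideanSpace.single 1 1) 1
      = 2 * lam * W u x ^ 3 + W u x ^ 2 := by
  have hg : DifferentiableAt ℝ (gradient u) x :=
    ((contDiffOn_gradient hD hu.1).differentiableOn (by norm_num)).differentiableAt
      (hD.mem_nhds hx)
  have hW := W_pos u x
  have hWinv : HasFDerivAt (fun y => (W u y)⁻¹) _ x :=
    (hasDerivAt_inv hW.ne').comp_hasFDerivAt x (hasFDerivAt_W hg)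
  have hX := hWinv.smul hg.hasFDerivAt
  have heq := hu.2 x hx
  have hsq := W_sq u x
  rw [div2, show fderiv ℝ (fun y => (W u y)⁻¹ • gradient u y) x = _ from hX.fderiv] at heq
  simp only [Fin.sum_univ_two, add_apply, smul_apply, ContinuousLinearMap.smulRight_apply,
    ContinuousLinearMap.comp_apply, innerSL_apply_apply,
    PiLp.add_apply, PiLp.smul_apply, smul_eq_mul, PiLp.inner_apply, RCLike.inner_apply,
    conj_trivial] at heq
  field_simp at heq
  linear_combination heq - (fderiv ℝ (gradient u) x (EuclideanSpace.single 0 1) 0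
    + fderiv ℝ (gradient u) x (EuclideanSpace.single 1 1) 1) * hsq

/-- First and second order conditions at an interior maximum of `u₁ - u₂ + ε exp (α x₀)`. -/
lemma conditions_of_isLocalMax {D : Set E2} (hD : IsOpen D) {u₁ u₂ : E2 → ℝ}
    (hu₁ : ContDiffOn ℝ 2 u₁ D) (hu₂ : ContDiffOn ℝ 2 u₂ D) {α ε : ℝ} {z : E2} (hz : z ∈ D)
    (hmax : IsLocalMax (fun y => u₁ y - u₂ y + ε * Real.exp (α * y 0)) z) (v : E2) :
    inner ℝ (gradient u₁ z) v - inner ℝ (gradient u₂ z) v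
        + ε * (Real.exp (α * z 0) * (α * v 0)) = 0 ∧
      inner ℝ (fderiv ℝ (gradient u₁) z v) v - inner ℝ (fderiv ℝ (gradient u₂) z v) v
        + ε * (Real.exp (α * z 0) * (α * v 0) * (α * v 0)) ≤ 0 := by
  have hline : ∀ t : ℝ, HasDerivAt (fun t : ℝ => z + t • v) v t := fun t => by
    simpa using ((hasDerivAt_id t).smul_const v).const_add z
  have hcont : Tendsto (fun t : ℝ => z + t • v) (𝓝 0) (𝓝 z) := by
    simpa using (hline 0).continuousAt.tendsto
  have hexp : ∀ t : ℝ, HasDerivAt (fun t : ℝ => Real.exp (α * (z + t • v) 0))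
      (Real.exp (α * (z + t • v) 0) * (α * v 0)) t := fun t => by
    have : HasDerivAt (fun t : ℝ => α * (z + t • v) 0) (α * v 0) t := by
      simpa using (((hasDerivAt_id t).mul_const (v 0)).const_add (z 0)).const_mul α
    exact this.exp
  have hfirst : ∀ u : E2 → ℝ, ContDiffOn ℝ 2 u D → ∀ t : ℝ, z + t • v ∈ D →
      HasDerivAt (fun t : ℝ => u (z + t • v)) (inner ℝ (gradient u (z + t • v)) v) t := by
    intro u hu t ht
    have hd : DifferentiableAt ℝ u (z + t • v) :=
      (hu.differentiableOn (by norm_num)).differentiableAt (hD.mem_nhds ht)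
    rw [inner_gradient_left]
    exact hd.hasFDerivAt.comp_hasDerivAt t (hline t)
  have hsecond : ∀ u : E2 → ℝ, ContDiffOn ℝ 2 u D →
      HasDerivAt (fun t : ℝ => inner ℝ (gradient u (z + t • v)) v)
        (inner ℝ (fderiv ℝ (gradient u) z v) v) 0 := by
    intro u hu
    have hd : DifferentiableAt ℝ (gradient u) (z + (0 : ℝ) • v) := by
      simpa using ((contDiffOn_gradient hD hu).differentiableOn (by norm_num)).differentiableAt
        (hD.mem_nhds hz)
    have h := (hd.hasFDerivAt.comp_hasDerivAt (0 : ℝ) (hline 0)).inner ℝ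
      (hasDerivAt_const (0 : ℝ) v)
    simpa using h
  have hmax' : IsLocalMax (fun t : ℝ => u₁ (z + t • v) - u₂ (z + t • v)
      + ε * Real.exp (α * (z + t • v) 0)) 0 := by
    have := hcont.eventually hmax
    simpa [IsLocalMax, IsMaxFilter] using this
  have hder : ∀ᶠ t in 𝓝 (0 : ℝ), HasDerivAt (fun t : ℝ => u₁ (z + t • v) - u₂ (z + t • v)
      + ε * Real.exp (α * (z + t • v) 0))
      (inner ℝ (gradient u₁ (z + t • v)) v - inner ℝ (gradient u₂ (z + t • v)) v
        + ε * (Real.exp (α * (z + t • v) 0) * (α * v 0))) t := by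
    filter_upwards [hcont.eventually (hD.mem_nhds hz)] with t ht
    exact ((hfirst u₁ hu₁ t ht).sub (hfirst u₂ hu₂ t ht)).add ((hexp t).const_mul ε)
  refine ⟨by simpa using hmax'.hasDerivAt_eq_zero hder.self_of_nhds, ?_⟩
  refine hmax'.second_deriv_nonpos hder ?_
  have := ((hsecond u₁ hu₁).sub (hsecond u₂ hu₂)).add
    (((hexp 0).mul_const (α * v 0)).const_mul ε)
  simp only [zero_smul, add_zero] at this
  exact this

/-- The gradient and Hessian entries of a `C²` function are bounded on compact subsets. -/
lemma exists_bound_of_contDiffOn {D K : Set E2} (hD : IsOpen D) (hK : IsCompact K) (hKD : K ⊆ D)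
    {u : E2 → ℝ} (hu : ContDiffOn ℝ 2 u D) :
    ∃ B, ∀ x ∈ K, (∀ i, |gradient u x i| ≤ B) ∧
      ∀ i j, |fderiv ℝ (gradient u) x (EuclideanSpace.single i 1) j| ≤ B := by
  have hg := contDiffOn_gradient hD hu
  obtain ⟨B₁, hB₁⟩ := hK.exists_bound_of_continuousOn (hg.continuousOn.mono hKD)
  obtain ⟨B₂, hB₂⟩ := hK.exists_bound_of_continuousOn
    ((hg.continuousOn_fderiv_of_isOpen hD le_rfl).mono hKD)
  refine ⟨max B₁ B₂, fun x hx => ⟨fun i => ?_, fun i j => ?_⟩⟩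
  · exact (PiLp.norm_apply_le (gradient u x) i).trans ((hB₁ x hx).trans (le_max_left _ _))
  · refine (PiLp.norm_apply_le (fderiv ℝ (gradient u) x (EuclideanSpace.single i 1)) j).trans
      (le_trans ?_ ((hB₂ x hx).trans (le_max_right _ _)))
    simpa using (fderiv ℝ (gradient u) x).le_opNorm (EuclideanSpace.single i 1)

/-- The algebraic core: if two solutions have gradients `(p, q)` and `(p + s, q)`, `s > 0`, then
the nondivergence operator applied to their difference is at least `-C * s`. -/
lemma le_of_nondivergence_eq {lam B p q s α V₁ V₂ a b d a' b' d' : ℝ} (hs : 0 < s)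
    (hα : 0 ≤ α) (hp : |p| ≤ B) (hq : |q| ≤ B) (hps : |p + s| ≤ B) (hb' : |b'| ≤ 2 * B)
    (hd' : |d'| ≤ B) (hV₁ : 0 < V₁) (hV₂ : 0 < V₂)
    (hV₁sq : V₁ ^ 2 = 1 + p ^ 2 + q ^ 2) (hV₂sq : V₂ ^ 2 = 1 + (p + s) ^ 2 + q ^ 2)
    (h₁ : (1 + q ^ 2) * a - p * q * b + (1 + p ^ 2) * d = 2 * lam * V₁ ^ 3 + V₁ ^ 2)
    (h₂ : (1 + q ^ 2) * a' - (p + s) * q * b' + (1 + (p + s) ^ 2) * d'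
      = 2 * lam * V₂ ^ 3 + V₂ ^ 2)
    (hle : (1 + q ^ 2) * (a - a') - p * q * (b - b') + (1 + p ^ 2) * (d - d')
      ≤ -(α * s * (1 + q ^ 2))) :
    α ≤ 6 * |lam| * (1 + 2 * B) ^ 2 + 2 * B + 4 * B ^ 2 := by
  have hB : 0 ≤ B := (abs_nonneg p).trans hp
  have hpB := sq_le_sq' (abs_le.1 hp).1 (abs_le.1 hp).2
  have hqB := sq_le_sq' (abs_le.1 hq).1 (abs_le.1 hq).2
  have hpsB := sq_le_sq' (abs_le.1 hps).1 (abs_le.1 hps).2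
  have hV₁B : V₁ ≤ 1 + 2 * B := (sq_le_sq₀ (by positivity) (by positivity)).1
    (by linarith [sq_nonneg B])
  have hV₂B : V₂ ≤ 1 + 2 * B := (sq_le_sq₀ (by positivity) (by positivity)).1
    (by linarith [sq_nonneg B])
  have hpV : |p| ≤ V₁ := abs_le_of_sq_le_sq (by linarith [sq_nonneg q]) hV₁.le
  have hpsV : |p + s| ≤ V₂ := abs_le_of_sq_le_sq (by linarith [sq_nonneg q]) hV₂.le
  have hmid : |2 * p + s| ≤ |p| + |p + s| := by
    simpa [two_mul, add_assoc] using abs_add_le p (p + s)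
  obtain ⟨r, hr, hVr⟩ : ∃ r, |r| ≤ 1 ∧ V₂ - V₁ = s * r := by
    refine ⟨(2 * p + s) / (V₁ + V₂), ?_, ?_⟩
    · rw [abs_div, abs_of_pos (by positivity : 0 < V₁ + V₂), div_le_one (by positivity)]
      linarith
    · field_simp
      linear_combination hV₂sq - hV₁sq
  have hcube : |2 * lam * r * (V₁ ^ 2 + V₁ * V₂ + V₂ ^ 2)| ≤ 6 * |lam| * (1 + 2 * B) ^ 2 := by
    have hpos : 0 ≤ V₁ ^ 2 + V₁ * V₂ + V₂ ^ 2 := by positivity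
    have hsum : V₁ ^ 2 + V₁ * V₂ + V₂ ^ 2 ≤ 3 * (1 + 2 * B) ^ 2 := by
      have h11 : V₁ ^ 2 ≤ (1 + 2 * B) ^ 2 := by gcongr
      have h22 : V₂ ^ 2 ≤ (1 + 2 * B) ^ 2 := by gcongr
      have h12 : V₁ * V₂ ≤ (1 + 2 * B) * (1 + 2 * B) := by gcongr
      linarith
    rw [abs_mul, abs_mul, abs_mul, abs_two, abs_of_nonneg hpos]
    calc 2 * |lam| * |r| * (V₁ ^ 2 + V₁ * V₂ + V₂ ^ 2)
        ≤ 2 * |lam| * 1 * (3 * (1 + 2 * B) ^ 2) := by gcongr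
      _ = _ := by ring
  have hqb : |q * b'| ≤ B * (2 * B) := by
    rw [abs_mul]; gcongr
  have hpd : |(2 * p + s) * d'| ≤ 2 * B * B := by
    rw [abs_mul]; gcongr; linarith
  have key : s * (α * (1 + q ^ 2)) ≤ s * (2 * lam * r * (V₁ ^ 2 + V₁ * V₂ + V₂ ^ 2)
      + (2 * p + s) + q * b' - (2 * p + s) * d') := by
    linear_combination hle - h₁ + h₂ + hV₂sq - hV₁sq
      + 2 * lam * (V₁ ^ 2 + V₁ * V₂ + V₂ ^ 2) * hVr
  have key' := le_of_mul_le_mul_left key hs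
  have := le_abs_self (2 * lam * r * (V₁ ^ 2 + V₁ * V₂ + V₂ ^ 2))
  have := le_abs_self (2 * p + s)
  have := le_abs_self (q * b')
  have := neg_abs_le ((2 * p + s) * d')
  have := mul_nonneg hα (sq_nonneg q)
  linarith

/-- Comparison principle: two solutions ordered on the boundary are ordered inside. -/
lemma le_of_satisfiesSolitonEq {D : Set E2} (hD : IsOpen D) (hDbdd : Bornology.IsBounded D)
    {lam : ℝ} {u₁ u₂ : E2 → ℝ} (hc₁ : ContinuousOn u₁ (closure D))
    (hc₂ : ContinuousOn u₂ (closure D)) (h₁ : SatisfiesSolitonEq lam D u₁)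
    (h₂ : SatisfiesSolitonEq lam D u₂) (hbdry : ∀ x ∈ frontier D, u₁ x ≤ u₂ x) :
    ∀ x ∈ closure D, u₁ x ≤ u₂ x := by
  intro x₀ hx₀
  by_contra! hlt
  have hcomp : IsCompact (closure D) := hDbdd.isCompact_closure
  have hw : ContinuousOn (fun x => u₁ x - u₂ x) (closure D) := hc₁.sub hc₂
  set c := u₁ x₀ - u₂ x₀
  have hcpos : 0 < c := sub_pos.2 hlt
  set K := closure D ∩ (fun x => u₁ x - u₂ x) ⁻¹' Set.Ici (c / 2)
  have hK : IsCompact K :=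
    hcomp.of_isClosed_subset (hw.preimage_isClosed_of_isClosed isClosed_closure isClosed_Ici)
      Set.inter_subset_left
  have hKD : K ⊆ D := by
    rintro x ⟨hx, hxc⟩
    by_contra hxD
    have hxf : x ∈ frontier D := by rw [hD.frontier_eq]; exact ⟨hx, hxD⟩
    have := hbdry x hxf
    have : c / 2 ≤ u₁ x - u₂ x := hxc
    linarith
  obtain ⟨B₁, hB₁⟩ := exists_bound_of_contDiffOn hD hK hKD h₁.1
  obtain ⟨B₂, hB₂⟩ := exists_bound_of_contDiffOn hD hK hKD h₂.1
  set B := max |B₁| |B₂|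
  have hB₁B : B₁ ≤ B := (le_abs_self _).trans (le_max_left _ _)
  have hB₂B : B₂ ≤ B := (le_abs_self _).trans (le_max_right _ _)
  have hB : 0 ≤ B := (abs_nonneg B₁).trans (le_max_left _ _)
  set α := 6 * |lam| * (1 + 2 * B) ^ 2 + 2 * B + 4 * B ^ 2 + 1 with hαdef
  have hα : 0 < α := by positivity
  have hφ : Continuous fun x : E2 => Real.exp (α * x 0) := by fun_prop
  obtain ⟨S, hS⟩ := hcomp.exists_bound_of_continuousOn hφ.continuousOn
  have hSpos : 0 < S := (norm_pos_iff.2 (Real.exp_pos _).ne').trans_le (hS x₀ hx₀)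
  set ε := c / (2 * S) with hεdef
  have hε : 0 < ε := by positivity
  obtain ⟨z, hz, hzmax⟩ := hcomp.exists_isMaxOn ⟨x₀, hx₀⟩
    (hw.add (hφ.continuousOn.const_mul ε))
  have hzK : z ∈ K := by
    refine ⟨hz, ?_⟩
    have hle : u₁ x₀ - u₂ x₀ + ε * Real.exp (α * x₀ 0)
      ≤ u₁ z - u₂ z + ε * Real.exp (α * z 0) := hzmax hx₀
    have hzS : ε * Real.exp (α * z 0) ≤ ε * S :=
      mul_le_mul_of_nonneg_left ((le_abs_self _).trans (hS z hz)) hε.le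
    have hεS : ε * S = c / 2 := by rw [hεdef]; field_simp
    have := mul_pos hε (Real.exp_pos (α * x₀ 0))
    change c / 2 ≤ u₁ z - u₂ z
    linarith
  have hzD := hKD hzK
  have hloc : IsLocalMax (fun y => u₁ y - u₂ y + ε * Real.exp (α * y 0)) z :=
    hzmax.isLocalMax (mem_of_superset (hD.mem_nhds hzD) subset_closure)
  have hcond := conditions_of_isLocalMax hD h₁.1 h₂.1 hzD hloc
  set s := ε * (Real.exp (α * z 0) * α)
  have hs : 0 < s := by positivity
  have hg0 : gradient u₂ z 0 = gradient u₁ z 0 + s := by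
    have := (hcond (EuclideanSpace.single 0 1)).1
    simp [-inner_gradient_left, EuclideanSpace.inner_single_right] at this
    linarith
  have hg1 : gradient u₂ z 1 = gradient u₁ z 1 := by
    have := (hcond (EuclideanSpace.single 1 1)).1
    simp [-inner_gradient_left, EuclideanSpace.inner_single_right] at this
    linarith
  have hQ : ∀ m n : ℝ,
      m ^ 2 * (fderiv ℝ (gradient u₁) z (EuclideanSpace.single 0 1) 0
          - fderiv ℝ (gradient u₂) z (EuclideanSpace.single 0 1) 0)
        + m * n * ((fderiv ℝ (gradient u₁) z (EuclideanSpace.single 0 1) 1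
            + fderiv ℝ (gradient u₁) z (EuclideanSpace.single 1 1) 0)
          - (fderiv ℝ (gradient u₂) z (EuclideanSpace.single 0 1) 1
            + fderiv ℝ (gradient u₂) z (EuclideanSpace.single 1 1) 0))
        + n ^ 2 * (fderiv ℝ (gradient u₁) z (EuclideanSpace.single 1 1) 1
          - fderiv ℝ (gradient u₂) z (EuclideanSpace.single 1 1) 1) + α * s * m ^ 2 ≤ 0 := by
    intro m n
    have := (hcond (m • EuclideanSpace.single 0 1 + n • EuclideanSpace.single 1 1)).2
    simp only [map_add, map_smul, inner_add_left, inner_add_right, inner_smul_left,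
      inner_smul_right, EuclideanSpace.inner_single_right, conj_trivial, PiLp.add_apply,
      PiLp.smul_apply, smul_eq_mul, PiLp.single_apply] at this
    norm_num at this
    linear_combination this
  obtain ⟨hb₁, -⟩ := hB₁ z hzK
  obtain ⟨hb₂, hb₂'⟩ := hB₂ z hzK
  have e₁ := h₁.nondivergence hD hzD
  have e₂ := h₂.nondivergence hD hzD
  have w₂ := W_sq u₂ z
  have hps := (hb₂ 0).trans hB₂B
  rw [hg0, hg1] at e₂ w₂
  rw [hg0] at hps
  have hfin := le_of_nondivergence_eq hs hα.le ((hb₁ 0).trans hB₁B) ((hb₁ 1).trans hB₁B) hps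
    ((abs_add_le _ _).trans (by linarith [hb₂' 0 1, hb₂' 1 0])) ((hb₂' 1 1).trans hB₂B)
    (W_pos u₁ z) (W_pos u₂ z) (W_sq u₁ z) w₂ e₁ e₂
    (by linear_combination hQ 1 0 + hQ 0 1 + hQ (gradient u₁ z 1) (-gradient u₁ z 0))
  linarith

/-- Uniqueness of the Dirichlet problem for λ-translating graphs. -/
theorem dirichlet_uniqueness
    (D : Set E2) (hD : D.Nonempty) (hDopen : IsOpen D) (hDbdd : Bornology.IsBounded D)
    (lam : ℝ) (u₁ u₂ : E2 → ℝ)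
    (hc₁ : ContinuousOn u₁ (closure D)) (hc₂ : ContinuousOn u₂ (closure D))
    (h₁ : SatisfiesSolitonEq lam D u₁) (h₂ : SatisfiesSolitonEq lam D u₂)
    (hbdry : ∀ x ∈ frontier D, u₁ x = u₂ x) :
    ∀ x ∈ closure D, u₁ x = u₂ x := fun x hx =>
  le_antisymm
    (le_of_satisfiesSolitonEq hDopen hDbdd hc₁ hc₂ h₁ h₂ (fun y hy => (hbdry y hy).le) x hx)
    (le_of_satisfiesSolitonEq hDopen hDbdd hc₂ hc₁ h₂ h₁ (fun y hy => (hbdry y hy).ge) x hx)
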